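/- arXiv:1505.06460 — 6 statements merged into one kernel-verified Lean document; each statement's English description precedes it below -/
import Mathlib

section
/- Let (Y,d) be a closure space and L a complete lattice. Define c_L : Set L → Set L by c_L(A) = {x ∈ L | x ≤ sSup A}; then c_L is a closure operator on the powerset of L, and the assignment sending a continuous map g : (Y,d) → (L,c_L) to the map C(Y,d) → L given by B ↦ sSup(g(B)) is a bijection between the set of continuous maps (Y,d) → (L,c_L) and the set of maps f : C(Y,d) → L satisfying f(d(⋃_{i∈I} B_i)) = ⨆_{i∈I} f(B_i) for every (possibly empty) family {B_i}_{i∈I} of closed subsets of (Y,d). -/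
universe u v

/-- A continuous map into `(L, c_L)` has the same supremum on a set and on its closure. -/
theorem sSup_image_closure_eq {Y : Type u} {L : Type v} [CompleteLattice L]
    {d : Set Y → Set Y} (hext : ∀ A : Set Y, A ⊆ d A) {g : Y → L}
    (hg : ∀ B : Set Y, g '' (d B) ⊆ {x : L | x ≤ sSup (g '' B)}) (B : Set Y) :
    sSup (g '' d B) = sSup (g '' B) :=
  le_antisymm (sSup_le fun _ hx => hg B hx) (sSup_le_sSup (Set.image_mono (hext B)))

/-- The closure of a set is the closure of the union of the closures of its points. -/
theorem closure_iUnion_closure_singleton {Y : Type u} {d : Set Y → Set Y}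
    (hmono : ∀ A B : Set Y, A ⊆ B → d A ⊆ d B) (hext : ∀ A : Set Y, A ⊆ d A)
    (hidem : ∀ A : Set Y, d (d A) = d A) (S : Set Y) :
    d (⋃ b : S, d {b.1}) = d S := by
  apply subset_antisymm
  · rw [← hidem S]
    exact hmono _ _ (Set.iUnion_subset fun b => hmono _ _ (Set.singleton_subset_iff.2 b.2))
  · exact hmono _ _ fun y hy => Set.mem_iUnion.2 ⟨⟨y, hy⟩, hext _ rfl⟩

/-- A sup-preserving map on closed sets is determined by its values on closures of points. -/
theorem map_closure_eq_sSup_image {Y : Type u} {L : Type v} [CompleteLattice L]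
    {d : Set Y → Set Y}
    (hmono : ∀ A B : Set Y, A ⊆ B → d A ⊆ d B) (hext : ∀ A : Set Y, A ⊆ d A)
    (hidem : ∀ A : Set Y, d (d A) = d A) {f : {B : Set Y // d B = B} → L}
    (hf : ∀ (ι : Type u) (B : ι → {B : Set Y // d B = B}),
      f ⟨d (⋃ i, (B i).1), hidem _⟩ = ⨆ i, f (B i)) (S : Set Y) :
    f ⟨d S, hidem S⟩ = sSup ((fun y => f ⟨d {y}, hidem _⟩) '' S) := by
  rw [sSup_image', ← hf S fun b => ⟨d {b.1}, hidem _⟩]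
  exact congrArg f (Subtype.ext (closure_iUnion_closure_singleton hmono hext hidem S).symm)

/-- For a closure space `(Y, d)` and a complete lattice `L`, the
operator `c_L A = {x | x ≤ sSup A}` is a closure operator on the powerset of
`L`, and `g ↦ (B ↦ sSup (g '' B))` is a bijection between continuous maps
`(Y, d) → (L, c_L)` and sup-preserving maps `C(Y, d) → L`. -/
theorem continuous_maps_biject_sup_preserving {Y : Type u} {L : Type v}
    [CompleteLattice L]
    (d : Set Y → Set Y)
    (hmono : ∀ A B : Set Y, A ⊆ B → d A ⊆ d B)
    (hext : ∀ A : Set Y, A ⊆ d A)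
    (hidem : ∀ A : Set Y, d (d A) = d A) :
    ((∀ A B : Set L, A ⊆ B → {x : L | x ≤ sSup A} ⊆ {x : L | x ≤ sSup B}) ∧
     (∀ A : Set L, A ⊆ {x : L | x ≤ sSup A}) ∧
     (∀ A : Set L, {x : L | x ≤ sSup {z : L | z ≤ sSup A}} = {x : L | x ≤ sSup A})) ∧
    Set.BijOn
      (fun (g : Y → L) => fun (B : {B : Set Y // d B = B}) => sSup (g '' B.1))
      {g : Y → L | ∀ B : Set Y, g '' (d B) ⊆ {x : L | x ≤ sSup (g '' B)}}
      {f : {B : Set Y // d B = B} → L |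
        ∀ (ι : Type u) (B : ι → {B : Set Y // d B = B}),
          f ⟨d (⋃ i, (B i).1), hidem _⟩ = ⨆ i, f (B i)} := by
  refine ⟨⟨fun A B h x hx => le_trans hx (sSup_le_sSup h), fun A x hx => le_sSup hx,
    fun A => ?_⟩, ?_, ?_, ?_⟩
  · ext x
    exact ⟨fun hx => le_trans hx (sSup_le fun _ hz => hz), fun hx => le_sSup hx⟩
  · intro g hg ι B
    change sSup (g '' d (⋃ i, (B i).1)) = ⨆ i, sSup (g '' (B i).1)
    rw [sSup_image_closure_eq hext hg, Set.image_iUnion, sSup_iUnion]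
  · intro g hg k hk h
    funext y
    have hy : sSup (g '' d {y}) = sSup (k '' d {y}) := congrFun h ⟨d {y}, hidem _⟩
    simpa [sSup_image_closure_eq hext hg, sSup_image_closure_eq hext hk] using hy
  · intro f hf
    have key := map_closure_eq_sSup_image hmono hext hidem hf
    refine ⟨fun y => f ⟨d {y}, hidem _⟩, fun B => ?_, ?_⟩
    · intro x hx
      refine (le_sSup hx).trans ?_
      rw [← key, ← key]
      exact le_of_eq (congrArg f (Subtype.ext (hidem B)))
    · funext B
      exact (key B.1).symm.trans (congrArg f (Subtype.ext B.2))
end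

section
/- Let Y be a set, {(X_i,c_i)}_{i∈I} a (possibly empty) family of closure spaces and ζ_i ⊆ X_i × Y relations. Define d(B) = ⋂_{i∈I} (ζ_i)_*(c_i(ζ_i*(B))) for B ⊆ Y (so d(B) = Y when I is empty). Then: (1) d is a closure operator on the powerset of Y; (2) each ζ_i : (X_i,c_i) ⇸ (Y,d) is a continuous relation; (3) for every closure space (Z,e) and every relation η ⊆ Y × Z, η : (Y,d) ⇸ (Z,e) is continuous if and only if the composite η ∘ ζ_i : (X_i,c_i) ⇸ (Z,e) is continuous for every i ∈ I, where η ∘ ζ_i = {(x,z) | ∃ y ∈ Y, (x,y) ∈ ζ_i and (y,z) ∈ η}. -/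
universe u

/-- The inverse-image operator `ζ*` of a relation `ζ ⊆ X × Y`. -/
def relStar {X Y : Type*} (ζ : Set (X × Y)) (B : Set Y) : Set X :=
  {x : X | ∃ y ∈ B, (x, y) ∈ ζ}

/-- The right adjoint `ζ_*` of `ζ*` for a relation `ζ ⊆ X × Y`. -/
def relLower {X Y : Type*} (ζ : Set (X × Y)) (A : Set X) : Set Y :=
  {y : Y | ∀ x : X, (x, y) ∈ ζ → x ∈ A}

/-- The composite of relations `ζ ⊆ X × Y` and `η ⊆ Y × Z`. -/
def relComp {X Y Z : Type*} (η : Set (Y × Z)) (ζ : Set (X × Y)) : Set (X × Z) :=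
  {p : X × Z | ∃ y : Y, (p.1, y) ∈ ζ ∧ (y, p.2) ∈ η}

theorem relStar_subset_iff {X Y : Type*} (ζ : Set (X × Y)) (B : Set Y) (A : Set X) :
    relStar ζ B ⊆ A ↔ B ⊆ relLower ζ A :=
  ⟨fun h y hy _ hxy => h ⟨y, hy, hxy⟩, fun h x ⟨_, hy, hxy⟩ => h hy x hxy⟩

theorem relStar_mono {X Y : Type*} (ζ : Set (X × Y)) {A B : Set Y} (h : A ⊆ B) :
    relStar ζ A ⊆ relStar ζ B :=
  fun _ ⟨y, hy, hxy⟩ => ⟨y, h hy, hxy⟩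

theorem relStar_relComp {X Y Z : Type*} (η : Set (Y × Z)) (ζ : Set (X × Y)) (C : Set Z) :
    relStar (relComp η ζ) C = relStar ζ (relStar η C) := by
  ext x
  exact ⟨fun ⟨z, hz, y, hxy, hyz⟩ => ⟨y, ⟨z, hz, hyz⟩, hxy⟩,
    fun ⟨y, ⟨z, hz, hyz⟩, hxy⟩ => ⟨z, hz, y, hxy, hyz⟩⟩

/-- Final (U-final) lifting of a structured sink of closure
spaces along relations: `d B = ⋂ i, (ζ i)_* (c i ((ζ i)* B))` is a closure
operator on `Y`, each `ζ i` is a continuous relation, and a relation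
`η ⊆ Y × Z` into a closure space `(Z, e)` is continuous iff every composite
`η ∘ ζ i` is continuous. -/
theorem final_closure_structure {Y : Type*} {ι : Type*} {X : ι → Type*}
    (c : ∀ i, Set (X i) → Set (X i))
    (hcmono : ∀ i, ∀ A B : Set (X i), A ⊆ B → c i A ⊆ c i B)
    (hcext : ∀ i, ∀ A : Set (X i), A ⊆ c i A)
    (hcidem : ∀ i, ∀ A : Set (X i), c i (c i A) = c i A)
    (ζ : ∀ i, Set (X i × Y))
    (d : Set Y → Set Y)
    (hd : ∀ B : Set Y, d B = ⋂ i, relLower (ζ i) (c i (relStar (ζ i) B))) :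
    ((∀ A B : Set Y, A ⊆ B → d A ⊆ d B) ∧
     (∀ B : Set Y, B ⊆ d B) ∧
     (∀ B : Set Y, d (d B) = d B)) ∧
    (∀ i, ∀ B : Set Y, relStar (ζ i) (d B) ⊆ c i (relStar (ζ i) B)) ∧
    (∀ (Z : Type u) (e : Set Z → Set Z),
      (∀ A B : Set Z, A ⊆ B → e A ⊆ e B) →
      (∀ A : Set Z, A ⊆ e A) →
      (∀ A : Set Z, e (e A) = e A) →
      ∀ η : Set (Y × Z),
        ((∀ C : Set Z, relStar η (e C) ⊆ d (relStar η C)) ↔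
          ∀ i, ∀ C : Set Z,
            relStar (relComp η (ζ i)) (e C) ⊆ c i (relStar (relComp η (ζ i)) C))) := by
  have subset_d_iff (A B : Set Y) :
      A ⊆ d B ↔ ∀ i, relStar (ζ i) A ⊆ c i (relStar (ζ i) B) := by
    simp only [hd, Set.subset_iInter_iff, relStar_subset_iff]
  have hcont (i) (B : Set Y) : relStar (ζ i) (d B) ⊆ c i (relStar (ζ i) B) :=
    (subset_d_iff _ _).1 subset_rfl i
  have hext (B : Set Y) : B ⊆ d B := (subset_d_iff _ _).2 fun i => hcext i _
  refine ⟨⟨fun A B h => ?_, hext, fun B => ?_⟩, hcont, fun Z e _ _ _ η => ?_⟩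
  · exact (subset_d_iff _ _).2 fun i =>
      (hcont i A).trans (hcmono i _ _ (relStar_mono _ h))
  · refine Set.Subset.antisymm ((subset_d_iff _ _).2 fun i => ?_) (hext _)
    rw [← hcidem i (relStar (ζ i) B)]
    exact (hcont i _).trans (hcmono i _ _ (hcont i B))
  · simp only [relStar_relComp, subset_d_iff]
    exact forall_comm
end

section
/- Let ζ : (X,c) ⇸ (Y,d) be a continuous relation between closure spaces. Then: (1) c((cl ζ)*(B)) = c(ζ*(B)) for all B ⊆ Y; (2) cl ζ : (X,c) ⇸ (Y,d) is a closed continuous relation. -/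
/-- The closure of a relation `ζ ⊆ X × Y` with respect to a closure operator
`c` on the powerset of `X`. -/
def clRel {X Y : Type*} (c : Set X → Set X) (ζ : Set (X × Y)) : Set (X × Y) :=
  {p : X × Y | p.1 ∈ c {x : X | (x, p.2) ∈ ζ}}

theorem relStar_subset_relStar_clRel {X Y : Type*} {c : Set X → Set X}
    (hcext : ∀ A : Set X, A ⊆ c A) (ζ : Set (X × Y)) (B : Set Y) :
    relStar ζ B ⊆ relStar (clRel c ζ) B := by
  rintro x ⟨y, hy, hxy⟩
  exact ⟨y, hy, hcext _ hxy⟩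

theorem relStar_clRel_subset {X Y : Type*} {c : Set X → Set X}
    (hcmono : ∀ A B : Set X, A ⊆ B → c A ⊆ c B) (ζ : Set (X × Y)) (B : Set Y) :
    relStar (clRel c ζ) B ⊆ c (relStar ζ B) := by
  rintro x ⟨y, hy, hxy⟩
  exact hcmono {z | (z, y) ∈ ζ} (relStar ζ B) (fun _ hz => ⟨y, hy, hz⟩) hxy

/-- For a continuous relation `ζ : (X,c) ⇸ (Y,d)`:
(1) `c ((cl ζ)* B) = c (ζ* B)` for all `B ⊆ Y`;
(2) `cl ζ : (X,c) ⇸ (Y,d)` is a closed continuous relation. -/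
theorem clRel_closure_eq_and_closed_continuous {X Y : Type*}
    (c : Set X → Set X) (d : Set Y → Set Y)
    (hcmono : ∀ A B : Set X, A ⊆ B → c A ⊆ c B)
    (hcext : ∀ A : Set X, A ⊆ c A)
    (hcidem : ∀ A : Set X, c (c A) = c A)
    (hdmono : ∀ A B : Set Y, A ⊆ B → d A ⊆ d B)
    (hdext : ∀ A : Set Y, A ⊆ d A)
    (hdidem : ∀ A : Set Y, d (d A) = d A)
    (ζ : Set (X × Y))
    (hζ : ∀ B : Set Y, relStar ζ (d B) ⊆ c (relStar ζ B)) :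
    (∀ B : Set Y, c (relStar (clRel c ζ) B) = c (relStar ζ B)) ∧
    (∀ B : Set Y, relStar (clRel c ζ) (d B) ⊆ c (relStar (clRel c ζ) B)) ∧
    (∀ y : Y, c {x : X | (x, y) ∈ clRel c ζ} = {x : X | (x, y) ∈ clRel c ζ}) := by
  have hle : ∀ A B : Set X, A ⊆ c B → c A ⊆ c B := fun A B h =>
    (hcmono _ _ h).trans (hcidem B).subset
  refine ⟨fun B => ?_, fun B => ?_, fun y => hcidem {x : X | (x, y) ∈ ζ}⟩
  · exact (hle _ _ (relStar_clRel_subset hcmono ζ B)).antisymm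
      (hcmono _ _ (relStar_subset_relStar_clRel hcext ζ B))
  · calc relStar (clRel c ζ) (d B) ⊆ c (relStar ζ (d B)) := relStar_clRel_subset hcmono ζ (d B)
      _ ⊆ c (relStar ζ B) := hle _ _ (hζ B)
      _ ⊆ c (relStar (clRel c ζ) B) := hcmono _ _ (relStar_subset_relStar_clRel hcext ζ B)
end

section
/- The closure operation cl on relations into a closure space (X,c) is a nucleus: (1) ζ ⊆ η implies cl ζ ⊆ cl η for relations ζ, η ⊆ X × Y; (2) ζ ⊆ cl ζ for every relation ζ ⊆ X × Y; (3) cl(cl ζ) = cl ζ for every relation ζ ⊆ X × Y; (4) for continuous relations ζ : (X,c) ⇸ (Y,d) and η : (Y,d) ⇸ (Z,e), one has (cl η) ∘ (cl ζ) ⊆ cl(η ∘ ζ), where η ∘ ζ = {(x,z) | ∃ y ∈ Y, (x,y) ∈ ζ and (y,z) ∈ η} and the closures of ζ and η ∘ ζ are taken with respect to (X,c) while the closure of η is taken with respect to (Y,d). -/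
universe u

/-- The closure operation `cl` on relations into a closure space
`(X, c)` is a nucleus: it is monotone, extensive and idempotent, and
`(cl η) ∘ (cl ζ) ⊆ cl (η ∘ ζ)` for continuous relations `ζ : (X,c) ⇸ (Y,d)`
and `η : (Y,d) ⇸ (Z,e)`. -/
theorem clRel_nucleus {X : Type*} (c : Set X → Set X)
    (hcmono : ∀ A B : Set X, A ⊆ B → c A ⊆ c B)
    (hcext : ∀ A : Set X, A ⊆ c A)
    (hcidem : ∀ A : Set X, c (c A) = c A) :
    (∀ (Y : Type u) (ζ η : Set (X × Y)), ζ ⊆ η → clRel c ζ ⊆ clRel c η) ∧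
    (∀ (Y : Type u) (ζ : Set (X × Y)), ζ ⊆ clRel c ζ) ∧
    (∀ (Y : Type u) (ζ : Set (X × Y)), clRel c (clRel c ζ) = clRel c ζ) ∧
    (∀ (Y Z : Type u) (d : Set Y → Set Y) (e : Set Z → Set Z),
      (∀ A B : Set Y, A ⊆ B → d A ⊆ d B) →
      (∀ A : Set Y, A ⊆ d A) →
      (∀ A : Set Y, d (d A) = d A) →
      (∀ A B : Set Z, A ⊆ B → e A ⊆ e B) →
      (∀ A : Set Z, A ⊆ e A) →
      (∀ A : Set Z, e (e A) = e A) →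
      ∀ (ζ : Set (X × Y)) (η : Set (Y × Z)),
        (∀ B : Set Y, relStar ζ (d B) ⊆ c (relStar ζ B)) →
        (∀ C : Set Z, relStar η (e C) ⊆ d (relStar η C)) →
        relComp (clRel d η) (clRel c ζ) ⊆ clRel c (relComp η ζ)) := by
  refine ⟨fun Y ζ η h p hp => hcmono _ _ (fun x hx => h hx) hp,
    fun Y ζ p hp => hcext _ hp, fun Y ζ => ?_, ?_⟩
  · ext p
    exact Set.ext_iff.mp (hcidem {x : X | (x, p.2) ∈ ζ}) p.1
  · rintro Y Z d e - - - - - - ζ η hζ - ⟨x, z⟩ ⟨y, hx, hy⟩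
    have hfiber : {x : X | (x, y) ∈ ζ} ⊆ c (relStar ζ {y : Y | (y, z) ∈ η}) :=
      fun x' hx' => hζ _ ⟨y, hy, hx'⟩
    have hxc : x ∈ c (relStar ζ {y : Y | (y, z) ∈ η}) := by
      rw [← hcidem]
      exact hcmono _ _ hfiber hx
    refine hcmono _ _ ?_ hxc
    rintro x' ⟨y', hy', hx'⟩
    exact ⟨y', hx', hy'⟩
end

section
/- Let (X,c) and (Y,d) be closure spaces and f : C(Y,d) → C(X,c) a sup-preserving map. Define the relation ζ = {(x,y) ∈ X × Y | x ∈ f(d({y}))}. Then ζ : (X,c) ⇸ (Y,d) is a continuous relation and c(ζ*(B)) = f(B) for every closed subset B of (Y,d). -/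
universe u v

/-- Every sup-preserving map `f : C(Y,d) → C(X,c)` between the
complete lattices of closed subsets arises from the continuous relation
`ζ = {(x, y) | x ∈ f (d {y})}`, via `B ↦ c (ζ* B)`. -/
theorem supPreserving_map_realized_by_continuous_relation {X : Type v} {Y : Type u}
    (c : Set X → Set X) (d : Set Y → Set Y)
    (hcmono : ∀ A B : Set X, A ⊆ B → c A ⊆ c B)
    (hcext : ∀ A : Set X, A ⊆ c A)
    (hcidem : ∀ A : Set X, c (c A) = c A)
    (hdmono : ∀ A B : Set Y, A ⊆ B → d A ⊆ d B)
    (hdext : ∀ A : Set Y, A ⊆ d A)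
    (hdidem : ∀ A : Set Y, d (d A) = d A)
    (f : {B : Set Y // d B = B} → {A : Set X // c A = A})
    (hf : ∀ (ι : Type u) (B : ι → {B : Set Y // d B = B}),
      f ⟨d (⋃ i, (B i).1), hdidem _⟩ = ⟨c (⋃ i, (f (B i)).1), hcidem _⟩)
    (ζ : Set (X × Y))
    (hζdef : ζ = {p : X × Y | p.1 ∈ (f ⟨d {p.2}, hdidem _⟩).1}) :
    (∀ B : Set Y, relStar ζ (d B) ⊆ c (relStar ζ B)) ∧
    (∀ (B : Set Y) (hB : d B = B), c (relStar ζ B) = (f ⟨B, hB⟩).1) := by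
  have key (B : Set Y) : c (relStar ζ B) = (f ⟨d B, hdidem B⟩).1 := by
    have hd : d (⋃ y : B, d {y.1}) = d B := by
      apply Set.Subset.antisymm
      · rw [← hdidem B]
        exact hdmono _ _ (Set.iUnion_subset fun y =>
          hdmono _ _ (Set.singleton_subset_iff.2 y.2))
      · exact hdmono _ _ fun y hy => Set.mem_iUnion.2 ⟨⟨y, hy⟩, hdext _ rfl⟩
    have hstar : relStar ζ B = ⋃ y : B, (f ⟨d {y.1}, hdidem _⟩).1 := by
      ext x
      simp only [relStar, hζdef, Set.mem_ofPred_eq, Set.mem_iUnion]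
      exact ⟨fun ⟨y, hy, hx⟩ => ⟨⟨y, hy⟩, hx⟩, fun ⟨y, hx⟩ => ⟨y.1, y.2, hx⟩⟩
    have hsup := congrArg Subtype.val (hf B fun y => ⟨d {y.1}, hdidem _⟩)
    simp only [hd] at hsup
    rw [hstar, hsup]
  refine ⟨fun B => ?_, fun B hB => ?_⟩
  · have h : c (relStar ζ (d B)) = c (relStar ζ B) := by
      simp only [key, hdidem]
    exact h ▸ hcext _
  · simp only [key, hB]
end

section
/- Let Q be a unital quantale. The following conditions are equivalent: (i) for all x, y ∈ Q, x ≤ y implies that there exist a, b ∈ Q with y * a = x and b * y = x; (ii) for all x, y ∈ Q, x ≤ y implies y * (y \ x) = x and (x / y) * y = x; (iii) for all x, y, z ∈ Q, if x ≤ z and y ≤ z then x * (z \ y) = (x / z) * y; (iv) for all x, y ∈ Q, x * (x \ y) = x ⊓ y and (y / x) * x = x ⊓ y. Moreover, if these equivalent conditions hold, then the unit 1 is the top element of Q. -/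
section UnitalQuantale

variable {Q : Type*} [CompleteLattice Q] [Monoid Q] [IsQuantale Q]

theorem mul_sSup_mul_le_le (x y : Q) : x * sSup {a : Q | x * a ≤ y} ≤ y := by
  rw [IsQuantale.mul_sSup_distrib]
  exact iSup₂_le fun _ h => h

theorem sSup_mul_le_mul_le (x y : Q) : sSup {b : Q | b * x ≤ y} * x ≤ y := by
  rw [IsQuantale.sSup_mul_distrib]
  exact iSup₂_le fun _ h => h

theorem one_eq_top_of_forall_le_exists_mul_eq
    (h : ∀ x y : Q, x ≤ y → ∃ b : Q, b * y = x) : (1 : Q) = ⊤ := by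
  obtain ⟨b, hb⟩ := h 1 ⊤ le_top
  have htop : (⊤ : Q) * ⊤ = ⊤ :=
    top_le_iff.mp ((mul_one (⊤ : Q)).symm.le.trans (mul_le_mul_right le_top ⊤))
  calc (1 : Q) = b * (⊤ * ⊤) := by rw [htop, hb]
    _ = ⊤ := by rw [← mul_assoc, hb, one_mul]

end UnitalQuantale


/-- Characterizations of divisibility for a unital quantale `Q`,
where `x \ z = sSup {a | x * a ≤ z}` and `z / y = sSup {a | a * y ≤ z}`;
moreover, in a divisible unital quantale the unit is the top element. -/
theorem divisible_quantale_tfae {Q : Type*} [CompleteLattice Q] [Monoid Q]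
    (hl : ∀ (x : Q) (S : Set Q), x * sSup S = ⨆ y ∈ S, x * y)
    (hr : ∀ (y : Q) (S : Set Q), sSup S * y = ⨆ x ∈ S, x * y) :
    ([ ∀ x y : Q, x ≤ y → ∃ a b : Q, y * a = x ∧ b * y = x,
       ∀ x y : Q, x ≤ y → y * sSup {a : Q | y * a ≤ x} = x ∧ sSup {b : Q | b * y ≤ x} * y = x,
       ∀ x y z : Q, x ≤ z → y ≤ z → x * sSup {a : Q | z * a ≤ y} = sSup {b : Q | b * z ≤ x} * y,
       ∀ x y : Q, x * sSup {a : Q | x * a ≤ y} = x ⊓ y ∧ sSup {b : Q | b * x ≤ y} * x = x ⊓ y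
     ].TFAE) ∧
    ((∀ x y : Q, x ≤ y → ∃ a b : Q, y * a = x ∧ b * y = x) → (1 : Q) = ⊤) := by
  have : IsQuantale Q := ⟨hl, fun S y => hr y S⟩
  have htop (h : ∀ x y : Q, x ≤ y → ∃ a b : Q, y * a = x ∧ b * y = x) : (1 : Q) = ⊤ :=
    one_eq_top_of_forall_le_exists_mul_eq fun x y hxy =>
      let ⟨_, b, _, hb⟩ := h x y hxy
      ⟨b, hb⟩
  refine ⟨?_, htop⟩
  tfae_have 1 → 2 := by
    intro h x y hxy
    obtain ⟨a, b, ha, hb⟩ := h x y hxy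
    refine ⟨(mul_sSup_mul_le_le y x).antisymm ?_, (sSup_mul_le_mul_le y x).antisymm ?_⟩
    · exact ha.ge.trans (mul_le_mul_right (le_sSup (by exact ha.le)) y)
    · exact hb.ge.trans (mul_le_mul_left (le_sSup (by exact hb.le)) y)
  tfae_have 2 → 1 := fun h x y hxy => ⟨_, _, h x y hxy⟩
  tfae_have 2 → 3 := by
    intro h x y z hxz hyz
    conv_lhs => rw [← (h x z hxz).2, mul_assoc, (h y z hyz).1]
  tfae_have 3 → 2 := by
    intro h x y hxy
    refine ⟨(mul_sSup_mul_le_le y x).antisymm ?_, (sSup_mul_le_mul_le y x).antisymm ?_⟩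
    · rw [h y x y le_rfl hxy]
      exact (one_mul x).ge.trans (mul_le_mul_left (le_sSup (by exact (one_mul y).le)) x)
    · rw [← h x y y hxy le_rfl]
      exact (mul_one x).ge.trans (mul_le_mul_right (le_sSup (by exact (mul_one y).le)) x)
  tfae_have 2 → 4 := by
    intro h x y
    have hle (a : Q) : a ≤ 1 := le_top.trans_eq (htop fun x y hxy => ⟨_, _, h x y hxy⟩).symm
    obtain ⟨h₁, h₂⟩ := h (x ⊓ y) x inf_le_left
    constructor
    · refine (le_inf ?_ (mul_sSup_mul_le_le x y)).antisymm (h₁.ge.trans ?_)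
      · exact (mul_le_mul_right (hle _) x).trans_eq (mul_one x)
      · exact mul_le_mul_right (sSup_le_sSup fun _ ha => ha.trans inf_le_right) x
    · refine (le_inf ?_ (sSup_mul_le_mul_le x y)).antisymm (h₂.ge.trans ?_)
      · exact (mul_le_mul_left (hle _) x).trans_eq (one_mul x)
      · exact mul_le_mul_left (sSup_le_sSup fun _ hb => hb.trans inf_le_right) x
  tfae_have 4 → 2 := by
    intro h x y hxy
    have := h y x
    rwa [inf_eq_right.mpr hxy] at this
  tfae_finish
end
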